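/- Let B = ℤ[(1+√−7)/2] (the ring of integers of ℚ(√−7)), set θ = (1+√−7)/2 and let θ̄ = (1−√−7)/2 be its conjugate. Let a, b, c ∈ B and A = B[X,Y]/(aX² + bXY + cY² − 1). Then A is a smooth B-algebra if and only if one of the following holds: (i) b is divisible by neither θ nor θ̄; (ii) b is not divisible by θ and a, b, c are all divisible by θ̄; (iii) b is not divisible by θ̄ and a, b, c are all divisible by θ; (iv) a, b, c are all divisible by 2. -/

import Mathlib

set_option synthInstance.maxHeartbeats 800000
set_option maxHeartbeats 1600000

open MvPolynomial

/-- `θ = (1 + √−7)/2` as a complex number. -/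
noncomputable def theta : ℂ := (1 + Real.sqrt 7 * Complex.I) / 2

/-- `B = ℤ[θ]`, the ring of integers of `ℚ(√−7)`, realized as a subalgebra of `ℂ`. -/
noncomputable def B : Subalgebra ℤ ℂ := Algebra.adjoin ℤ {theta}

/-- `θ` as an element of `B`. -/
noncomputable def θB : B := ⟨theta, Algebra.subset_adjoin rfl⟩

/-- The conjugate `θ̄ = 1 − θ` as an element of `B`. -/
noncomputable def θbarB : B := 1 - θB

/-- The polynomial `a X² + b XY + c Y² - 1` in `B[X,Y]`. -/
noncomputable abbrev quadPoly (a b c : B) : MvPolynomial (Fin 2) B :=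
  C a * X 0 ^ 2 + C b * X 0 * X 1 + C c * X 1 ^ 2 - 1

/-- The ring `A = B[X,Y]/(a X² + b XY + c Y² - 1)`. -/
noncomputable abbrev QuadAlg (a b c : B) :=
  MvPolynomial (Fin 2) B ⧸ Ideal.span {quadPoly a b c}

lemma θB_mul_θbarB : θB * θbarB = 2 := by
  apply Subtype.ext
  have h7 : (Real.sqrt 7 : ℂ) ^ 2 = 7 := by
    exact_mod_cast Real.sq_sqrt (show (0 : ℝ) ≤ 7 by norm_num)
  change theta * (1 - theta) = 2
  unfold theta
  linear_combination (-(Real.sqrt 7 : ℂ) ^ 2 / 4) * Complex.I_sq + h7 / 4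

lemma θB_add_θbarB : θB + θbarB = 1 := by
  simp [θbarB]

/-- An element of `B` dividing `2` and one of `θB`, `θB - 1` has residue ring `{0, 1}`. -/
lemma dvd_or_dvd_sub_one {p : B} (h2 : p ∣ 2) (hθ : p ∣ θB ∨ p ∣ θB - 1) (z : B) :
    p ∣ z ∨ p ∣ z - 1 := by
  obtain ⟨z, hz⟩ := z
  induction hz using Algebra.adjoin_induction with
  | mem x hx =>
    obtain rfl : x = theta := hx
    exact hθ
  | algebraMap r =>
    have hr : (⟨algebraMap ℤ ℂ r, (algebraMap ℤ B r).2⟩ : B) = (r : B) := Subtype.ext (by simp)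
    rw [hr]
    rcases Int.even_or_odd' r with ⟨k, rfl | rfl⟩
    · exact .inl (by push_cast; exact h2.mul_right _)
    · exact .inr (by push_cast; simpa using h2.mul_right _)
  | add x y hx hy ihx ihy =>
    change p ∣ (⟨x, hx⟩ + ⟨y, hy⟩ : B) ∨ p ∣ (⟨x, hx⟩ + ⟨y, hy⟩ : B) - 1
    generalize (⟨x, hx⟩ : B) = u at *
    generalize (⟨y, hy⟩ : B) = v at *
    rcases ihx with ihx | ihx <;> rcases ihy with ihy | ihy
    · exact .inl (ihx.add ihy)
    · exact .inr (by simpa [add_sub_assoc] using ihx.add ihy)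
    · exact .inr (by simpa [sub_add_eq_add_sub] using ihx.add ihy)
    · refine .inl ?_
      convert (ihx.add ihy).add h2 using 1
      ring
  | mul x y hx hy ihx ihy =>
    change p ∣ (⟨x, hx⟩ * ⟨y, hy⟩ : B) ∨ p ∣ (⟨x, hx⟩ * ⟨y, hy⟩ : B) - 1
    generalize (⟨x, hx⟩ : B) = u at *
    generalize (⟨y, hy⟩ : B) = v at *
    rcases ihx with ihx | ihx
    · exact .inl (ihx.mul_right _)
    rcases ihy with ihy | ihy
    · exact .inl (ihy.mul_left _)
    · refine .inr ?_
      convert (ihx.mul_right v).add ihy using 1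
      ring

lemma θB_dvd_or_dvd_sub_one (z : B) : θB ∣ z ∨ θB ∣ z - 1 :=
  dvd_or_dvd_sub_one ⟨θbarB, θB_mul_θbarB.symm⟩ (.inl dvd_rfl) z

lemma θbarB_dvd_or_dvd_sub_one (z : B) : θbarB ∣ z ∨ θbarB ∣ z - 1 :=
  dvd_or_dvd_sub_one ⟨θB, by rw [mul_comm, θB_mul_θbarB]⟩
    (.inr ⟨-1, by rw [θbarB]; ring⟩) z

lemma two_dvd_iff (z : B) : (2 : B) ∣ z ↔ θB ∣ z ∧ θbarB ∣ z := by
  have hco : IsCoprime θB θbarB := ⟨1, 1, by simpa using θB_add_θbarB⟩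
  rw [← θB_mul_θbarB]
  exact ⟨fun h ↦ ⟨(dvd_mul_right _ _).trans h, (dvd_mul_left _ _).trans h⟩,
    fun h ↦ hco.mul_dvd h.1 h.2⟩

section QuadAlg

variable {a b c : B} {S : Type*} [CommRing S] [Algebra B S]

lemma aeval_quadPoly (x y : S) :
    aeval ![x, y] (quadPoly a b c) =
      algebraMap B S a * x ^ 2 + algebraMap B S b * x * y + algebraMap B S c * y ^ 2 - 1 := by
  simp [quadPoly]

lemma exists_algHom_quadAlg (x y : S)
    (h : algebraMap B S a * x ^ 2 + algebraMap B S b * x * y + algebraMap B S c * y ^ 2 - 1 = 0) :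
    ∃ f : QuadAlg a b c →ₐ[B] S,
      f (Ideal.Quotient.mk _ (X 0)) = x ∧ f (Ideal.Quotient.mk _ (X 1)) = y := by
  refine ⟨Ideal.Quotient.liftₐ _ (aeval ![x, y]) fun z hz ↦ ?_, ?_, ?_⟩
  · obtain ⟨w, rfl⟩ := Ideal.mem_span_singleton.mp hz
    rw [map_mul, aeval_quadPoly, h, zero_mul]
  · exact (aeval_X ![x, y] 0).trans rfl
  · exact (aeval_X ![x, y] 1).trans rfl

lemma quadAlg_hom_relation (f : QuadAlg a b c →ₐ[B] S) :
    algebraMap B S a * f (Ideal.Quotient.mk _ (X 0)) ^ 2 +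
      algebraMap B S b * f (Ideal.Quotient.mk _ (X 0)) * f (Ideal.Quotient.mk _ (X 1)) +
      algebraMap B S c * f (Ideal.Quotient.mk _ (X 1)) ^ 2 - 1 = 0 := by
  have hg : f.comp (Ideal.Quotient.mkₐ B (Ideal.span {quadPoly a b c})) =
      aeval ![f (Ideal.Quotient.mk _ (X 0)), f (Ideal.Quotient.mk _ (X 1))] :=
    MvPolynomial.algHom_ext fun i ↦ by fin_cases i <;> simp
  rw [← aeval_quadPoly, ← hg, AlgHom.comp_apply, Ideal.Quotient.mkₐ_eq_mk,
    Ideal.Quotient.eq_zero_iff_mem.mpr (Ideal.mem_span_singleton_self _), map_zero]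

lemma quadAlg_algHom_ext {f g : QuadAlg a b c →ₐ[B] S}
    (h0 : f (Ideal.Quotient.mk _ (X 0)) = g (Ideal.Quotient.mk _ (X 0)))
    (h1 : f (Ideal.Quotient.mk _ (X 1)) = g (Ideal.Quotient.mk _ (X 1))) : f = g :=
  Ideal.Quotient.algHom_ext _ (MvPolynomial.algHom_ext fun i ↦ by
    fin_cases i
    · exact h0
    · exact h1)

end QuadAlg

lemma jacobian_sup_span_eq_top {R : Type*} [CommRing R] {p a b c x y : R} {J : Ideal R}
    (h2 : p ∣ 2) (hf : a * x ^ 2 + b * x * y + c * y ^ 2 - 1 ∈ J)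
    (hx : 2 * a * x + b * y ∈ J) (hy : b * x + 2 * c * y ∈ J)
    (h : p ∣ b - 1 ∨ p ∣ a ∧ p ∣ b ∧ p ∣ c) :
    J ⊔ Ideal.span {p} = ⊤ := by
  rw [Ideal.eq_top_iff_one, Submodule.mem_sup]
  rcases h with h | h
  · obtain ⟨t, ht⟩ := h2
    obtain ⟨e, he⟩ := h
    refine ⟨(a * x + b * y) * (b * x + 2 * c * y) + c * y * (2 * a * x + b * y)
      - (a * x ^ 2 + b * x * y + c * y ^ 2 - 1), ?_, _,
      Ideal.mem_span_singleton'.mpr ⟨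
        -((a * x + b * y) * (e * x + t * c * y)) - c * y * (e * y + t * a * x), rfl⟩, ?_⟩
    · exact J.sub_mem (J.add_mem (J.mul_mem_left _ hy) (J.mul_mem_left _ hx)) hf
    · linear_combination ((a * x + b * y) * x + c * y * y) * he +
        ((a * x + b * y) * (c * y) + c * y * (a * x)) * ht
  · obtain ⟨⟨a', rfl⟩, ⟨b', rfl⟩, ⟨c', rfl⟩⟩ := h
    refine ⟨_, J.neg_mem hf, _, Ideal.mem_span_singleton'.mpr
      ⟨a' * x ^ 2 + b' * x * y + c' * y ^ 2, rfl⟩, by ring⟩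

lemma exists_jacobian_combination {a b c : B} (h1 : θB ∣ b - 1 ∨ θB ∣ a ∧ θB ∣ b ∧ θB ∣ c)
    (h2 : θbarB ∣ b - 1 ∨ θbarB ∣ a ∧ θbarB ∣ b ∧ θbarB ∣ c)
    {S : Type*} [CommRing S] (φ : B →+* S) (x y : S) :
    ∃ u v w : S, u * (φ a * x ^ 2 + φ b * x * y + φ c * y ^ 2 - 1) +
      v * (2 * φ a * x + φ b * y) + w * (φ b * x + 2 * φ c * y) = 1 := by
  let J : Ideal S := Ideal.span {φ a * x ^ 2 + φ b * x * y + φ c * y ^ 2 - 1,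
    2 * φ a * x + φ b * y, φ b * x + 2 * φ c * y}
  have hf : φ a * x ^ 2 + φ b * x * y + φ c * y ^ 2 - 1 ∈ J := Ideal.subset_span (by simp)
  have hx : 2 * φ a * x + φ b * y ∈ J := Ideal.subset_span (by simp)
  have hy : φ b * x + 2 * φ c * y ∈ J := Ideal.subset_span (by simp)
  have hmul : φ θB * φ θbarB = 2 := by rw [← map_mul, θB_mul_θbarB, map_ofNat]
  have key (p : B) (hp : φ p ∣ 2) (h : p ∣ b - 1 ∨ p ∣ a ∧ p ∣ b ∧ p ∣ c) :
      J ⊔ Ideal.span {φ p} = ⊤ := by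
    refine jacobian_sup_span_eq_top hp hf hx hy (h.imp (fun h ↦ ?_) fun h ↦
      ⟨map_dvd φ h.1, map_dvd φ h.2.1, map_dvd φ h.2.2⟩)
    simpa using map_dvd φ h
  have htwo : (2 : S) ∈ J := by
    have := J.sub_mem (J.add_mem (J.mul_mem_left x hx) (J.mul_mem_left y hy))
      (J.mul_mem_left 2 hf)
    convert this using 1
    ring
  have htop : J = ⊤ := by
    have h := Ideal.sup_mul_eq_of_coprime_left (K := Ideal.span {φ θbarB})
      (key θB ⟨_, hmul.symm⟩ h1)
    rwa [key θbarB ⟨φ θB, by rw [mul_comm, hmul]⟩ h2, Ideal.span_singleton_mul_span_singleton,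
      hmul, sup_eq_left.mpr ((Ideal.span_singleton_le_iff_mem _).mpr htwo)] at h
  have h1 : (1 : S) ∈ J := htop ▸ Submodule.mem_top
  obtain ⟨u, z, hz, h⟩ := Ideal.mem_span_insert.mp h1
  obtain ⟨v, w, rfl⟩ := Ideal.mem_span_pair.mp hz
  exact ⟨u, v, w, (add_assoc _ _ _).trans h.symm⟩

lemma formallySmooth_quadAlg {a b c : B} (h1 : θB ∣ b - 1 ∨ θB ∣ a ∧ θB ∣ b ∧ θB ∣ c)
    (h2 : θbarB ∣ b - 1 ∨ θbarB ∣ a ∧ θbarB ∣ b ∧ θbarB ∣ c) :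
    Algebra.FormallySmooth B (QuadAlg a b c) := by
  refine Algebra.FormallySmooth.of_comp_surjective fun S _ _ I hI g ↦ ?_
  obtain ⟨x, hx⟩ := Ideal.Quotient.mk_surjective (g (Ideal.Quotient.mk _ (X 0)))
  obtain ⟨y, hy⟩ := Ideal.Quotient.mk_surjective (g (Ideal.Quotient.mk _ (X 1)))
  obtain ⟨u, v, w, huvw⟩ := exists_jacobian_combination h1 h2 (algebraMap B S) x y
  set f := algebraMap B S a * x ^ 2 + algebraMap B S b * x * y + algebraMap B S c * y ^ 2 - 1
    with hf
  have hfI : f ∈ I := by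
    rw [← Ideal.Quotient.eq_zero_iff_mem, ← quadAlg_hom_relation g, ← hx, ← hy, hf]
    simp only [map_sub, map_add, map_mul, map_pow, map_one]
    rfl
  have hf2 : f ^ 2 = 0 := by
    have := Ideal.pow_mem_pow hfI 2
    rwa [hI, Ideal.mem_bot] at this
  obtain ⟨F, hF0, hF1⟩ := exists_algHom_quadAlg (a := a) (b := b) (c := c)
    (x - f * v) (y - f * w) (by
      linear_combination (u + algebraMap B S a * v ^ 2 + algebraMap B S b * v * w +
        algebraMap B S c * w ^ 2) * hf2 - f * huvw - hf)
  refine ⟨F, quadAlg_algHom_ext ?_ ?_⟩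
  · rw [AlgHom.comp_apply, hF0, Ideal.Quotient.mkₐ_eq_mk, map_sub, map_mul,
      Ideal.Quotient.eq_zero_iff_mem.mpr hfI, zero_mul, sub_zero, hx]
  · rw [AlgHom.comp_apply, hF1, Ideal.Quotient.mkₐ_eq_mk, map_sub, map_mul,
      Ideal.Quotient.eq_zero_iff_mem.mpr hfI, zero_mul, sub_zero, hy]

/-- A quotient `S` of `B[T]` in which `p = 0` and the class `t` of `T` has `t ^ 3 = 0 ≠ t ^ 2`. -/
lemma exists_algebra_cube_zero {p : B} (hp : ¬ p ∣ 1) :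
    ∃ (S : Type) (_ : CommRing S) (_ : Algebra B S) (t : S),
      algebraMap B S p = 0 ∧ t ^ 3 = 0 ∧ t ^ 2 ≠ 0 := by
  have : Nontrivial (B ⧸ Ideal.span {p}) :=
    Ideal.Quotient.nontrivial_iff.mpr fun h ↦
      hp (Ideal.mem_span_singleton.mp (h ▸ Submodule.mem_top))
  let q : Polynomial (B ⧸ Ideal.span {p}) := Polynomial.X ^ 3
  refine ⟨AdjoinRoot q, inferInstance, inferInstance, AdjoinRoot.root q, ?_, ?_, ?_⟩
  · rw [IsScalarTower.algebraMap_apply B (B ⧸ Ideal.span {p}) (AdjoinRoot q),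
      Ideal.Quotient.algebraMap_eq,
      Ideal.Quotient.eq_zero_iff_mem.mpr (Ideal.mem_span_singleton_self p), map_zero]
  · rw [← AdjoinRoot.mk_X, ← map_pow, AdjoinRoot.mk_eq_zero]
  · rw [← AdjoinRoot.mk_X, ← map_pow, Ne, AdjoinRoot.mk_eq_zero, Polynomial.X_pow_dvd_iff]
    intro h
    simpa using h 2 (by norm_num)

lemma not_formallySmooth_quadAlg {p a b c : B} (h2 : p ∣ 2) (hp : ¬ p ∣ 1) (hb : p ∣ b)
    (h : ∃ r s, p ∣ a * r ^ 2 + c * s ^ 2 - 1) :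
    ¬ Algebra.FormallySmooth B (QuadAlg a b c) := by
  intro hsm
  obtain ⟨r, s, hrs⟩ := h
  obtain ⟨S, _, _, t, hpS, ht3, ht2⟩ := exists_algebra_cube_zero hp
  have hzero {z : B} (hz : p ∣ z) : algebraMap B S z = 0 := by
    obtain ⟨w, rfl⟩ := hz
    rw [map_mul, hpS, zero_mul]
  have hS2 : (2 : S) = 0 := by rw [← hzero h2, map_ofNat]
  have hSb := hzero hb
  have hSrs := hzero hrs
  simp only [map_sub, map_add, map_mul, map_pow, map_one] at hSrs
  let I : Ideal S := Ideal.span {t ^ 2}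
  have ht4 : t ^ 4 = 0 := by rw [pow_succ, ht3, zero_mul]
  have hI : I ^ 2 = ⊥ := by
    rw [Ideal.span_singleton_pow, ← pow_mul, ht4, Ideal.span_singleton_eq_bot.mpr rfl]
  have hrel : algebraMap B S a * (algebraMap B S r * (1 + t)) ^ 2 +
      algebraMap B S b * (algebraMap B S r * (1 + t)) * (algebraMap B S s * (1 + t)) +
      algebraMap B S c * (algebraMap B S s * (1 + t)) ^ 2 - 1 = t ^ 2 := by
    linear_combination (1 + t) ^ 2 * hSrs + t * hS2 +
      (algebraMap B S r * (1 + t)) * (algebraMap B S s * (1 + t)) * hSb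
  obtain ⟨g, hg0, hg1⟩ := exists_algHom_quadAlg (a := a) (b := b) (c := c) (S := S ⧸ I)
    (Ideal.Quotient.mk I (algebraMap B S r * (1 + t)))
    (Ideal.Quotient.mk I (algebraMap B S s * (1 + t))) (by
      have := congrArg (Ideal.Quotient.mk I) hrel
      rw [Ideal.Quotient.eq_zero_iff_mem.mpr (Ideal.mem_span_singleton_self (t ^ 2))] at this
      simp only [map_sub, map_add, map_mul, map_pow, map_one] at this ⊢
      exact this)
  obtain ⟨F, hF⟩ := Algebra.FormallySmooth.comp_surjective B (QuadAlg a b c) I hI g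
  have lift (z : QuadAlg a b c) (x : S) (hz : g z = Ideal.Quotient.mk I x) :
      ∃ m, F z = x + m * t ^ 2 := by
    have : Ideal.Quotient.mk I (F z) = Ideal.Quotient.mk I x := by rw [← hz, ← hF]; rfl
    obtain ⟨m, hm⟩ := Ideal.mem_span_singleton'.mp (Ideal.Quotient.eq.mp this)
    exact ⟨m, by rw [hm]; ring⟩
  obtain ⟨m, hm⟩ := lift _ _ hg0
  obtain ⟨n, hn⟩ := lift _ _ hg1
  have hF' := quadAlg_hom_relation F
  rw [hm, hn] at hF'
  generalize algebraMap B S r * (1 + t) = x at *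
  generalize algebraMap B S s * (1 + t) = y at *
  refine ht2 ?_
  linear_combination hF' - hrel
    - (algebraMap B S a * m ^ 2 + algebraMap B S c * n ^ 2) * ht4
    - (algebraMap B S a * x * m + algebraMap B S c * y * n) * t ^ 2 * hS2
    + (x * y - (x + m * t ^ 2) * (y + n * t ^ 2)) * hSb

lemma dvd_sub_one_or_iff {p a b c : B} (hp : ∀ z, p ∣ z ∨ p ∣ z - 1) :
    p ∣ b - 1 ∨ (p ∣ a ∧ p ∣ b ∧ p ∣ c) ↔ ¬ p ∣ b ∨ (p ∣ a ∧ p ∣ b ∧ p ∣ c) := by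
  refine ⟨fun h ↦ ?_, fun h ↦ h.imp_left (hp b).resolve_left⟩
  by_cases hb : p ∣ b
  · refine .inr (h.elim (fun h ↦ ?_) id)
    have h1 : p ∣ 1 := by simpa using dvd_sub hb h
    exact ⟨h1.trans (one_dvd _), hb, h1.trans (one_dvd _)⟩
  · exact .inl hb

lemma dvd_sub_one_or_dvd_of_smooth {p a b c : B} (h2 : p ∣ 2) (hp : ∀ z, p ∣ z ∨ p ∣ z - 1)
    (h : Algebra.FormallySmooth B (QuadAlg a b c)) :
    p ∣ b - 1 ∨ p ∣ a ∧ p ∣ b ∧ p ∣ c := by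
  by_cases hb : p ∣ b
  · by_cases h1 : p ∣ 1
    · exact .inl (h1.trans (one_dvd _))
    refine .inr ⟨(hp a).resolve_right fun ha ↦ ?_, hb, (hp c).resolve_right fun hc ↦ ?_⟩
    · exact not_formallySmooth_quadAlg h2 h1 hb ⟨1, 0, by simpa using ha⟩ h
    · exact not_formallySmooth_quadAlg h2 h1 hb ⟨0, 1, by simpa using hc⟩ h
  · exact .inl ((hp b).resolve_left hb)

theorem smooth_iff_sqrt_neg_seven (a b c : B) :
    Algebra.Smooth B (QuadAlg a b c) ↔
      (¬ θB ∣ b ∧ ¬ θbarB ∣ b) ∨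
      (¬ θB ∣ b ∧ θbarB ∣ a ∧ θbarB ∣ b ∧ θbarB ∣ c) ∨
      (¬ θbarB ∣ b ∧ θB ∣ a ∧ θB ∣ b ∧ θB ∣ c) ∨
      ((2 : B) ∣ a ∧ (2 : B) ∣ b ∧ (2 : B) ∣ c) := by
  rw [show Algebra.Smooth B (QuadAlg a b c) ↔ (θB ∣ b - 1 ∨ θB ∣ a ∧ θB ∣ b ∧ θB ∣ c) ∧
      (θbarB ∣ b - 1 ∨ θbarB ∣ a ∧ θbarB ∣ b ∧ θbarB ∣ c) from ?_]
  · rw [dvd_sub_one_or_iff θB_dvd_or_dvd_sub_one, dvd_sub_one_or_iff θbarB_dvd_or_dvd_sub_one,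
      two_dvd_iff, two_dvd_iff, two_dvd_iff]
    tauto
  · refine ⟨fun h ↦ ⟨?_, ?_⟩, fun h ↦ ⟨formallySmooth_quadAlg h.1 h.2,
      .quotient ⟨{quadPoly a b c}, by simp⟩⟩⟩
    · exact dvd_sub_one_or_dvd_of_smooth ⟨θbarB, θB_mul_θbarB.symm⟩ θB_dvd_or_dvd_sub_one
        h.formallySmooth
    · exact dvd_sub_one_or_dvd_of_smooth ⟨θB, by rw [mul_comm, θB_mul_θbarB]⟩
        θbarB_dvd_or_dvd_sub_one h.formallySmooth
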